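/- Let G[X,Y] be a finite bipartite graph and k ≥ 1 an integer with k·|Y| even; suppose G has no partial parity (g,f)-factor with respect to W = X, where f(v) = 2 for v ∈ X, f(v) = k for v ∈ Y, g(v) = 0 for v ∈ X, g(v) = k for v ∈ Y. If (A,B) is a biased barrier of G, then for every odd component D of G − (A ∪ B) and every vertex v ∈ V(D), the number of edges of G from v to B is at most 1. -/

import Mathlib

noncomputable section

/-- `eCnt G S T` is the number of edges of `G` with one endpoint in `S` and the other in `T`
(intended for disjoint `S` and `T`). -/
def eCnt {V : Type*} (G : SimpleGraph V) (S T : Set V) : ℕ :=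
  Nat.card {p : V × V // p.1 ∈ S ∧ p.2 ∈ T ∧ G.Adj p.1 p.2}

/-- The degree of `v` in `G − A` (the induced subgraph on the complement of `A`). -/
def degDel {V : Type*} (G : SimpleGraph V) (A : Set V) (v : V) : ℕ :=
  (G.neighborSet v \ A).ncard

/-- The vertex set of a connected component of an induced subgraph, viewed inside the
ambient vertex set. -/
def compSupp {V : Type*} {G : SimpleGraph V} {s : Set V}
    (c : (G.induce s).ConnectedComponent) : Set V :=
  Subtype.val '' c.supp

/-- A component `D` of `G − (A ∪ B)` is odd if `Σ_{v ∈ V(D)} f v + e_G(D,B)` is odd. -/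
def IsOddComp {V : Type*} (G : SimpleGraph V) (f : V → ℤ) (A B : Set V)
    (c : (G.induce (A ∪ B)ᶜ).ConnectedComponent) : Prop :=
  Odd ((∑ᶠ v ∈ compSupp c, f v) + (eCnt G (compSupp c) B : ℤ))

/-- A component `D` of `G − (A ∪ B)` is even if `Σ_{v ∈ V(D)} f v + e_G(D,B)` is even. -/
def IsEvenComp {V : Type*} (G : SimpleGraph V) (f : V → ℤ) (A B : Set V)
    (c : (G.induce (A ∪ B)ᶜ).ConnectedComponent) : Prop :=
  Even ((∑ᶠ v ∈ compSupp c, f v) + (eCnt G (compSupp c) B : ℤ))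

/-- `h_W(A,B)`: the number of components `D` of `G − (A ∪ B)` such that `g v = f v` for all
`v ∈ V(D) \ W` and `Σ_{v ∈ V(D)} f v + e_G(D,B) ≡ 1 (mod 2)`. -/
def hWnum {V : Type*} (G : SimpleGraph V) (W : Set V) (g f : V → ℤ) (A B : Set V) : ℕ :=
  Nat.card {c : (G.induce (A ∪ B)ᶜ).ConnectedComponent //
    (∀ v ∈ compSupp c \ W, g v = f v) ∧ IsOddComp G f A B c}

/-- `δ_G(A,B) = Σ_{v∈A} f v − Σ_{v∈B} g v + Σ_{v∈B} d_{G−A}(v) − h_W(A,B)`. -/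
def deltaG {V : Type*} (G : SimpleGraph V) (W : Set V) (g f : V → ℤ) (A B : Set V) : ℤ :=
  (∑ᶠ v ∈ A, f v) - (∑ᶠ v ∈ B, g v) + (∑ᶠ v ∈ B, (degDel G A v : ℤ)) -
    (hWnum G W g f A B : ℤ)

/-- `F` is a partial parity `(g,f)`-factor of `G` with respect to `W`: a spanning subgraph with
`g v ≤ d_F v ≤ f v` for all `v` and `d_F v ≡ g v ≡ f v (mod 2)` for `v ∈ W`. -/
def IsPPFactor {V : Type*} (G F : SimpleGraph V) (W : Set V) (g f : V → ℤ) : Prop :=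
  F ≤ G ∧
  (∀ v : V, g v ≤ ((F.neighborSet v).ncard : ℤ) ∧ ((F.neighborSet v).ncard : ℤ) ≤ f v) ∧
  (∀ v ∈ W, Int.ModEq 2 ((F.neighborSet v).ncard : ℤ) (g v) ∧
    Int.ModEq 2 ((F.neighborSet v).ncard : ℤ) (f v))

/-- `(A,B)` is a barrier: a pair of disjoint vertex sets with `δ_G(A,B) < 0`. -/
def IsBarrier {V : Type*} (G : SimpleGraph V) (W : Set V) (g f : V → ℤ) (A B : Set V) : Prop :=
  Disjoint A B ∧ deltaG G W g f A B < 0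

/-- `(A,B)` is a biased barrier: among all barriers, `δ_G(A,B)` is minimum; subject to that,
`|B|` is minimum; subject to that, `|A|` is maximum. -/
def IsBiasedBarrier {V : Type*} (G : SimpleGraph V) (W : Set V) (g f : V → ℤ)
    (A B : Set V) : Prop :=
  IsBarrier G W g f A B ∧
  (∀ A' B' : Set V, IsBarrier G W g f A' B' → deltaG G W g f A B ≤ deltaG G W g f A' B') ∧
  (∀ A' B' : Set V, IsBarrier G W g f A' B' →
    deltaG G W g f A' B' = deltaG G W g f A B → B.ncard ≤ B'.ncard) ∧
  (∀ A' B' : Set V, IsBarrier G W g f A' B' →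
    deltaG G W g f A' B' = deltaG G W g f A B → B'.ncard = B.ncard → A'.ncard ≤ A.ncard)

/-- The function `f` of the `(2,k)`-factor setting: `f = 2` on `X` and `f = k` on `Y`. -/
def fB (X Y : Type*) (k : ℕ) : X ⊕ Y → ℤ := Sum.elim (fun _ => 2) (fun _ => (k : ℤ))

/-- The function `g` of the `(2,k)`-factor setting: `g = 0` on `X` and `g = k` on `Y`. -/
def gB (X Y : Type*) (k : ℕ) : X ⊕ Y → ℤ := Sum.elim (fun _ => 0) (fun _ => (k : ℤ))

open scoped Classical in
lemma eCnt_eq_sum {V : Type*} [Fintype V] (G : SimpleGraph V) (S T : Set V) :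
    eCnt G S T = ∑ w, ∑ u, if w ∈ S ∧ u ∈ T ∧ G.Adj w u then 1 else 0 := by
  rw [eCnt, Nat.card_eq_fintype_card, Fintype.card_subtype, Finset.card_filter,
    Fintype.sum_prod_type]

open scoped Classical in
lemma eCnt_singleton_eq_sum {V : Type*} [Fintype V] (G : SimpleGraph V) (v : V) (T : Set V) :
    eCnt G {v} T = ∑ u, if u ∈ T ∧ G.Adj v u then 1 else 0 := by
  rw [eCnt_eq_sum, Fintype.sum_eq_single v]
  · simp only [Set.mem_singleton_iff, true_and]
  · intro w hw
    simp only [Set.mem_singleton_iff, hw, false_and, if_false, Finset.sum_const_zero]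

open scoped Classical in
lemma finsum_mem_eq_sum_ite {V M : Type*} [Fintype V] [AddCommMonoid M] (S : Set V) (f : V → M) :
    ∑ᶠ v ∈ S, f v = ∑ v, if v ∈ S then f v else 0 := by
  rw [finsum_eq_sum_of_fintype]
  exact Finset.sum_congr rfl fun v _ ↦ finsum_eq_if

/-- The edges from `S` to `T`, counted vertex by vertex in `S`. -/
lemma eCnt_eq_finsum_singleton {V : Type*} [Finite V] (G : SimpleGraph V) (S T : Set V) :
    (eCnt G S T : ℤ) = ∑ᶠ w ∈ S, (eCnt G {w} T : ℤ) := by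
  classical
  have := Fintype.ofFinite V
  rw [finsum_mem_eq_sum_ite, eCnt_eq_sum]
  push_cast
  refine Finset.sum_congr rfl fun w _ ↦ ?_
  split_ifs with h
  · simp [eCnt_singleton_eq_sum, h]
  · simp [h]

/-- Adding `v` to `A` lowers the sum of the degrees `d_{G-A}` over `B` by `e_G(v, B)`. -/
lemma finsum_degDel_insert {V : Type*} [Finite V] (G : SimpleGraph V) (A B : Set V) {v : V}
    (hv : v ∉ A) :
    ∑ᶠ u ∈ B, (degDel G A u : ℤ) =
      ∑ᶠ u ∈ B, (degDel G (insert v A) u : ℤ) + (eCnt G {v} B : ℤ) := by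
  classical
  have := Fintype.ofFinite V
  rw [finsum_mem_eq_sum_ite, finsum_mem_eq_sum_ite, eCnt_singleton_eq_sum]
  push_cast
  rw [← Finset.sum_add_distrib]
  refine Finset.sum_congr rfl fun u _ ↦ ?_
  by_cases hu : u ∈ B
  · have key : degDel G A u = degDel G (insert v A) u + if G.Adj v u then 1 else 0 := by
      rw [degDel, degDel, ← Set.union_singleton, ← Set.sdiff_sdiff]
      split_ifs with hvu
      · have hmem : v ∈ G.neighborSet u \ A := ⟨hvu.symm, hv⟩
        exact (Set.ncard_sdiff_singleton_add_one hmem (Set.toFinite _)).symm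
      · rw [Set.sdiff_singleton_eq_self fun h ↦ hvu (G.adj_symm h.1), add_zero]
    simp [hu, key]
  · simp [hu]

lemma compSupp_subset {V : Type*} {G : SimpleGraph V} {s : Set V}
    (c : (G.induce s).ConnectedComponent) : compSupp c ⊆ s := by
  rintro _ ⟨w, -, rfl⟩
  exact w.2

lemma eq_of_mem_compSupp {V : Type*} {G : SimpleGraph V} {s : Set V}
    {c d : (G.induce s).ConnectedComponent} {v : V} (hc : v ∈ compSupp c) (hd : v ∈ compSupp d) :
    c = d := by
  obtain ⟨a, ha, rfl⟩ := hc
  obtain ⟨b, hb, hab⟩ := hd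
  obtain rfl := Subtype.ext hab
  exact ha.symm.trans hb

lemma compSupp_nonempty {V : Type*} {G : SimpleGraph V} {s : Set V}
    (c : (G.induce s).ConnectedComponent) : (compSupp c).Nonempty :=
  c.nonempty_supp.image _

lemma compSupp_injective {V : Type*} (G : SimpleGraph V) (s : Set V) :
    Function.Injective (compSupp : (G.induce s).ConnectedComponent → Set V) := by
  intro c d h
  obtain ⟨v, hv⟩ := compSupp_nonempty c
  exact eq_of_mem_compSupp hv (h ▸ hv)

lemma iUnion_compSupp {V : Type*} (G : SimpleGraph V) (s : Set V) :
    ⋃ c : (G.induce s).ConnectedComponent, compSupp c = s :=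
  Set.Subset.antisymm (Set.iUnion_subset compSupp_subset) fun v hv ↦
    Set.mem_iUnion.2 ⟨(G.induce s).connectedComponentMk ⟨v, hv⟩, ⟨v, hv⟩, rfl, rfl⟩

/-- A component of `G[s]` which lies in `t` and has no edges to `t \ s` is a component of
`G[t]`. -/
lemma exists_compSupp_eq {V : Type*} {G : SimpleGraph V} {s t : Set V}
    (c : (G.induce s).ConnectedComponent) (hct : compSupp c ⊆ t)
    (hadj : ∀ u ∈ compSupp c, ∀ w ∈ t, G.Adj u w → w ∈ s) :
    ∃ d : (G.induce t).ConnectedComponent, compSupp d = compSupp c := by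
  obtain ⟨a, rfl⟩ := c.exists_rep
  have ha : (a : V) ∈ compSupp ((G.induce s).connectedComponentMk a) := ⟨a, rfl, rfl⟩
  change compSupp ((G.induce s).connectedComponentMk a) ⊆ t at hct
  refine ⟨(G.induce t).connectedComponentMk ⟨a, hct ha⟩, ?_⟩
  change _ = compSupp ((G.induce s).connectedComponentMk a)
  apply Set.Subset.antisymm
  · rintro _ ⟨b, hb, rfl⟩
    have hb' : (G.induce t).Reachable ⟨a, hct ha⟩ b :=
      (SimpleGraph.ConnectedComponent.exact hb).symm
    rw [SimpleGraph.reachable_iff_reflTransGen] at hb'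
    induction hb' with
    | refl => exact ha
    | tail hab hbc ih =>
      rename_i b c
      have hbS := ih (SimpleGraph.ConnectedComponent.sound
        (((G.induce t).reachable_iff_reflTransGen _ _).2 hab).symm)
      have hcs := hadj _ hbS _ c.2 hbc
      obtain ⟨b', hb', hbb'⟩ := hbS
      refine ⟨⟨c, hcs⟩, ?_, rfl⟩
      have : (G.induce s).Adj b' ⟨c, hcs⟩ := by
        change G.Adj (b' : V) c
        rw [hbb']
        exact hbc
      exact SimpleGraph.ConnectedComponent.sound
        (this.reachable.symm.trans (SimpleGraph.ConnectedComponent.exact hb'))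
  · rintro _ ⟨b, hb, rfl⟩
    have hb' : (G.induce s).Reachable a b := (SimpleGraph.ConnectedComponent.exact hb).symm
    rw [SimpleGraph.reachable_iff_reflTransGen] at hb'
    induction hb' with
    | refl => exact ⟨⟨a, hct ha⟩, rfl, rfl⟩
    | tail hab hbc ih =>
      rename_i b c
      have hbS := ih (SimpleGraph.ConnectedComponent.sound
        (((G.induce s).reachable_iff_reflTransGen _ _).2 hab).symm)
      obtain ⟨b', hb', hbb'⟩ := hbS
      have hct' : (c : V) ∈ t := hct ⟨c, hb, rfl⟩
      refine ⟨⟨c, hct'⟩, ?_, rfl⟩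
      have : (G.induce t).Adj b' ⟨c, hct'⟩ := by
        change G.Adj (b' : V) c
        rw [hbb']
        exact hbc
      exact SimpleGraph.ConnectedComponent.sound
        (this.reachable.symm.trans (SimpleGraph.ConnectedComponent.exact hb'))

/-- The vertex sets of the odd components of `G − (A ∪ B)`. -/
def oddSupps {V : Type*} (G : SimpleGraph V) (f : V → ℤ) (A B : Set V) : Set (Set V) :=
  compSupp '' {c | IsOddComp G f A B c}

lemma hWnum_eq_ncard_oddSupps {V : Type*} (G : SimpleGraph V) {W : Set V} {g f : V → ℤ}
    (hgf : ∀ v ∉ W, g v = f v) (A B : Set V) :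
    hWnum G W g f A B = (oddSupps G f A B).ncard := by
  rw [oddSupps, Set.ncard_image_of_injective _ (compSupp_injective G _), hWnum,
    ← Nat.card_coe_set_eq]
  exact Nat.card_congr (Equiv.subtypeEquivRight fun c ↦
    ⟨fun h ↦ h.2, fun h ↦ ⟨fun v hv ↦ hgf v hv.2, h⟩⟩)

/-- The number of odd components has the parity of the total weight of `G − (A ∪ B)`. -/
lemma hWnum_modEq_finsum {V : Type*} [Finite V] (G : SimpleGraph V) {W : Set V} {g f : V → ℤ}
    (hgf : ∀ v ∉ W, g v = f v) (A B : Set V) :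
    (hWnum G W g f A B : ℤ) ≡ ∑ᶠ w ∈ (A ∪ B)ᶜ, (f w + (eCnt G {w} B : ℤ)) [ZMOD 2] := by
  classical
  have := Fintype.ofFinite V
  have := Fintype.ofFinite (G.induce (A ∪ B)ᶜ).ConnectedComponent
  set φ : V → ℤ := fun w ↦ f w + (eCnt G {w} B : ℤ)
  have hcomp (c : (G.induce (A ∪ B)ᶜ).ConnectedComponent) :
      (∑ᶠ v ∈ compSupp c, f v) + (eCnt G (compSupp c) B : ℤ) = ∑ᶠ v ∈ compSupp c, φ v := by
    rw [eCnt_eq_finsum_singleton, finsum_mem_add_distrib (Set.toFinite _)]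
  have hsum : ∑ᶠ w ∈ (A ∪ B)ᶜ, φ w =
      ∑ c : (G.induce (A ∪ B)ᶜ).ConnectedComponent, ∑ᶠ v ∈ compSupp c, φ v := by
    rw [← finsum_eq_sum_of_fintype, ← finsum_mem_iUnion]
    · congr 1
      rw [iUnion_compSupp]
    · intro c d hcd
      exact Set.disjoint_left.2 fun v hc hd ↦ hcd (eq_of_mem_compSupp hc hd)
    · exact fun c ↦ Set.toFinite _
  rw [hsum]
  refine (ZMod.intCast_eq_intCast_iff _ _ 2).1 ?_
  have hcard : hWnum G W g f A B =
      (Finset.univ.filter fun c : (G.induce (A ∪ B)ᶜ).ConnectedComponent ↦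
        Odd (∑ᶠ v ∈ compSupp c, φ v)).card := by
    rw [hWnum, Nat.card_eq_fintype_card, Fintype.card_subtype]
    congr 1
    ext c
    simp only [Finset.mem_filter, Finset.mem_univ, true_and, IsOddComp, hcomp]
    exact ⟨fun h ↦ h.2, fun h ↦ ⟨fun v hv ↦ hgf v hv.2, h⟩⟩
  rw [hcard, Finset.card_filter]
  push_cast
  refine Finset.sum_congr rfl fun c _ ↦ ?_
  split_ifs with h
  · exact (ZMod.intCast_eq_one_iff_odd.2 h).symm
  · exact (ZMod.intCast_eq_zero_iff_even.2 (Int.not_odd_iff_even.1 h)).symm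

/-- Moving one vertex of `G − (A ∪ B)` to `A` destroys at most one odd component. -/
lemma hWnum_le_hWnum_insert_add_one {V : Type*} [Finite V] (G : SimpleGraph V) {W : Set V}
    {g f : V → ℤ} (hgf : ∀ v ∉ W, g v = f v) (A B : Set V)
    (c : (G.induce (A ∪ B)ᶜ).ConnectedComponent) {v : V} (hv : v ∈ compSupp c) :
    hWnum G W g f A B ≤ hWnum G W g f (insert v A) B + 1 := by
  rw [hWnum_eq_ncard_oddSupps G hgf, hWnum_eq_ncard_oddSupps G hgf]
  have hsub : oddSupps G f A B ⊆ insert (compSupp c) (oddSupps G f (insert v A) B) := by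
    rintro _ ⟨d, hd, rfl⟩
    by_cases hdc : d = c
    · exact Or.inl (congrArg _ hdc)
    · right
      obtain ⟨d', hd'⟩ := exists_compSupp_eq (t := (insert v A ∪ B)ᶜ) d
        (fun w hw ↦ by
          have h1 := compSupp_subset d hw
          have h2 : w ≠ v := by
            rintro rfl
            exact hdc (eq_of_mem_compSupp hw hv)
          simp_all)
        (fun u _ w hw _ ↦ by simp_all)
      refine ⟨d', ?_, hd'⟩
      change IsOddComp G f _ B d'
      rw [IsOddComp, hd']
      exact hd
  exact (Set.ncard_le_ncard hsub).trans (Set.ncard_insert_le _ _)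

/-- Removing `u` from `B` destroys at most `d_{G-A}(u)` odd components. -/
lemma hWnum_le_hWnum_sdiff_singleton_add {V : Type*} [Finite V] (G : SimpleGraph V) {W : Set V}
    {g f : V → ℤ} (hgf : ∀ v ∉ W, g v = f v) (A B : Set V) (u : V) :
    hWnum G W g f A B ≤ hWnum G W g f A (B \ {u}) + degDel G A u := by
  rw [hWnum_eq_ncard_oddSupps G hgf, hWnum_eq_ncard_oddSupps G hgf]
  set T : Set (Set V) := {S ∈ oddSupps G f A B | ∃ w ∈ S, G.Adj u w}
  have hTcard : T.ncard ≤ degDel G A u := by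
    have hch (S : Set V) : ∃ w, S ∈ T → w ∈ S ∧ G.Adj u w := by
      by_cases hS : S ∈ T
      · obtain ⟨w, h⟩ := hS.2
        exact ⟨w, fun _ ↦ h⟩
      · exact ⟨u, fun h ↦ absurd h hS⟩
    choose w hw using hch
    refine Set.ncard_le_ncard_of_injOn w ?_ ?_
    · rintro S hS
      refine ⟨(hw S hS).2, ?_⟩
      have h1 := (hw S hS).1
      obtain ⟨⟨d, -, rfl⟩, -⟩ := hS
      exact fun h ↦ compSupp_subset d h1 (Or.inl h)
    · intro S hS S' hS' h
      have h1 := (hw S hS).1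
      have h2 := (hw S' hS').1
      rw [← h] at h2
      obtain ⟨⟨d, -, rfl⟩, -⟩ := hS
      obtain ⟨⟨d', -, rfl⟩, -⟩ := hS'
      rw [eq_of_mem_compSupp h1 h2]
  have hsub : oddSupps G f A B ⊆ oddSupps G f A (B \ {u}) ∪ T := by
    rintro S hS
    by_cases hST : S ∈ T
    · exact Or.inr hST
    left
    have hna : ∀ w ∈ S, ¬ G.Adj u w := fun w hw h ↦ hST ⟨hS, w, hw, h⟩
    obtain ⟨d, hd, rfl⟩ := hS
    obtain ⟨d', hd'⟩ := exists_compSupp_eq (t := (A ∪ B \ {u})ᶜ) d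
      (fun w hw ↦ by
        have h1 := compSupp_subset d hw
        simp_all)
      (fun x hx w hw hadj ↦ by
        have : w ≠ u := by
          rintro rfl
          exact hna x hx hadj.symm
        simp_all)
    refine ⟨d', ?_, hd'⟩
    change IsOddComp G f _ _ d'
    have he : eCnt G (compSupp d) (B \ {u}) = eCnt G (compSupp d) B := by
      refine Nat.card_congr (Equiv.subtypeEquivRight fun p ↦ ?_)
      refine ⟨fun h ↦ ⟨h.1, h.2.1.1, h.2.2⟩, fun h ↦ ⟨h.1, ⟨h.2.1, ?_⟩, h.2.2⟩⟩
      rintro rfl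
      exact hna _ h.1 h.2.2.symm
    rw [IsOddComp, hd', he]
    exact hd
  exact (Set.ncard_le_ncard hsub).trans ((Set.ncard_union_le _ _).trans (by omega))

/-- Every vertex `u` of `B` in a biased barrier satisfies `0 < g u`. -/
lemma IsBiasedBarrier.pos_of_mem {V : Type*} [Finite V] {G : SimpleGraph V} {W : Set V}
    {g f : V → ℤ} (hgf : ∀ v ∉ W, g v = f v) {A B : Set V} (h : IsBiasedBarrier G W g f A B)
    {u : V} (hu : u ∈ B) : 0 < g u := by
  by_contra! hgu
  have h1 := hWnum_le_hWnum_sdiff_singleton_add G hgf A B u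
  have hsplit (φ : V → ℤ) : ∑ᶠ v ∈ B, φ v = φ u + ∑ᶠ v ∈ B \ {u}, φ v := by
    conv_lhs => rw [← Set.insert_sdiff_self_of_mem hu]
    rw [finsum_mem_insert _ (by simp) (Set.toFinite _)]
  have hle : deltaG G W g f A (B \ {u}) ≤ deltaG G W g f A B := by
    rw [deltaG, deltaG, hsplit g, hsplit fun v ↦ (degDel G A v : ℤ)]
    zify at h1
    linarith
  have hbar : IsBarrier G W g f A (B \ {u}) :=
    ⟨h.1.1.mono_right Set.sdiff_subset, hle.trans_lt h.1.2⟩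
  have h2 := h.2.2.1 _ _ hbar (le_antisymm hle (h.2.1 _ _ hbar))
  exact absurd h2 (not_le.2 (Set.ncard_sdiff_singleton_lt_of_mem hu))

/-- In a biased barrier, every vertex `v` outside `A ∪ B` sends fewer than `f v` edges
to `B`. -/
lemma IsBiasedBarrier.eCnt_lt {V : Type*} [Finite V] {G : SimpleGraph V} {W : Set V}
    {g f : V → ℤ} (hgf : ∀ v ∉ W, g v = f v) {A B : Set V} (h : IsBiasedBarrier G W g f A B)
    (c : (G.induce (A ∪ B)ᶜ).ConnectedComponent) {v : V} (hv : v ∈ compSupp c) :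
    (eCnt G {v} B : ℤ) < f v := by
  by_contra! hfv
  have hvAB : v ∉ A ∪ B := compSupp_subset c hv
  have hvA : v ∉ A := fun h ↦ hvAB (Or.inl h)
  have hvB : v ∉ B := fun h ↦ hvAB (Or.inr h)
  have h1 := hWnum_le_hWnum_insert_add_one G hgf A B c hv
  have hp := hWnum_modEq_finsum G hgf A B
  have hp' := hWnum_modEq_finsum G hgf (insert v A) B
  have hcompl : (A ∪ B)ᶜ = insert v (insert v A ∪ B)ᶜ := by
    ext w
    by_cases hw : w = v <;> simp_all
  rw [hcompl, finsum_mem_insert _ (by simp) (Set.toFinite _)] at hp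
  have hd : deltaG G W g f (insert v A) B + eCnt G {v} B + hWnum G W g f (insert v A) B =
      deltaG G W g f A B + f v + hWnum G W g f A B := by
    rw [deltaG, deltaG, finsum_mem_insert _ hvA (Set.toFinite _), finsum_degDel_insert G A B hvA]
    ring
  have hle : deltaG G W g f (insert v A) B ≤ deltaG G W g f A B := by
    unfold Int.ModEq at hp hp'
    omega
  have hbar : IsBarrier G W g f (insert v A) B :=
    ⟨Set.disjoint_insert_left.2 ⟨hvB, h.1.1⟩, hle.trans_lt h.1.2⟩
  have h2 := h.2.2.2 _ _ hbar (le_antisymm hle (h.2.1 _ _ hbar)) rfl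
  rw [Set.ncard_insert_of_notMem hvA] at h2
  omega

/-- for a biased barrier `(A,B)`, every vertex of an odd component of
`G − (A ∪ B)` sends at most one edge to `B`. -/
theorem biased_barrier_odd_comp_eB_le_one {X Y : Type*} [Fintype X] [Fintype Y]
    (G : SimpleGraph (X ⊕ Y))
    (hX : ∀ x x' : X, ¬ G.Adj (Sum.inl x) (Sum.inl x'))
    (hY : ∀ y y' : Y, ¬ G.Adj (Sum.inr y) (Sum.inr y'))
    (k : ℕ) (hk : 1 ≤ k) (heven : Even (k * Fintype.card Y))
    (hno : ¬ ∃ F : SimpleGraph (X ⊕ Y),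
      IsPPFactor G F (Set.range (Sum.inl : X → X ⊕ Y)) (gB X Y k) (fB X Y k))
    (A B : Set (X ⊕ Y))
    (hAB : IsBiasedBarrier G (Set.range (Sum.inl : X → X ⊕ Y)) (gB X Y k) (fB X Y k) A B)
    (c : (G.induce (A ∪ B)ᶜ).ConnectedComponent)
    (hodd : IsOddComp G (fB X Y k) A B c)
    (v : X ⊕ Y) (hv : v ∈ compSupp c) :
    eCnt G {v} B ≤ 1 := by
  have hgf : ∀ w ∉ Set.range (Sum.inl : X → X ⊕ Y), gB X Y k w = fB X Y k w := by
    rintro (x | y) hw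
    · exact absurd ⟨x, rfl⟩ hw
    · rfl
  rcases v with x | y
  · have h := hAB.eCnt_lt hgf c hv
    rw [show fB X Y k (Sum.inl x) = 2 from rfl] at h
    omega
  · have hempty : IsEmpty {p : (X ⊕ Y) × (X ⊕ Y) //
        p.1 ∈ ({Sum.inr y} : Set (X ⊕ Y)) ∧ p.2 ∈ B ∧ G.Adj p.1 p.2} := by
      refine ⟨?_⟩
      rintro ⟨⟨_, x | y'⟩, rfl, hB, hadj⟩
      · exact absurd (hAB.pos_of_mem hgf hB) (lt_irrefl _)
      · exact hY _ _ hadj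
    rw [eCnt, Nat.card_of_isEmpty]
    exact zero_le_one
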